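/- arXiv:2407.00804 — 2 statements merged into one kernel-verified Lean document; each statement's English description precedes it below -/
import Mathlib

section
/- Let R be a commutative ring (e.g. ℂ), n ≥ 1 an integer, m = ⌊n/2⌋, and let X = (x_{ij})_{i,j=1}^n be a tridiagonal matrix over R (x_{ij} = 0 whenever |i−j| > 1) all of whose diagonal entries equal a fixed element a. Set η_i = x_{i,i+1}·x_{i+1,i} for i = 1,…,n−1, and for j = 1,…,m define d_{m−j} = (−1)^j · Σ ∏_{k=1}^{j} η_{i_k}, where the sum runs over all j-element subsets {i_1 < i_2 < ⋯ < i_j} of {1,…,n−1} satisfying i_{k+1} − i_k ≥ 2 for k = 1,…,j−1. Put D_n = a^{2m} + Σ_{j=0}^{m−1} d_j a^{2j}. Then det X = D_n if n is even, and det X = a·D_n if n is odd. -/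
/-- The collection of subsets of `{0, …, N-1}` of cardinality `j` containing no two
consecutive integers. -/
def sparseSubsets (N j : ℕ) : Finset (Finset ℕ) :=
  (Finset.range N).powerset.filter (fun s => s.card = j ∧ ∀ i ∈ s, i + 1 ∉ s)

/-- Expansion of the determinant of a tridiagonal matrix along its last row and column. -/
theorem det_succ_succ_of_tridiagonal {R : Type*} [CommRing R] (n : ℕ)
    (x : Matrix (Fin (n + 2)) (Fin (n + 2)) R)
    (htri : ∀ i j : Fin (n + 2),
      ((i : ℕ) + 1 < (j : ℕ) ∨ (j : ℕ) + 1 < (i : ℕ)) → x i j = 0) :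
    x.det = x (Fin.last _) (Fin.last _) * (x.submatrix Fin.castSucc Fin.castSucc).det
      - x (Fin.last n).castSucc (Fin.last _) * x (Fin.last _) (Fin.last n).castSucc
        * (x.submatrix (fun i : Fin n => i.castSucc.castSucc)
            (fun i : Fin n => i.castSucc.castSucc)).det := by
  have minor : (x.submatrix Fin.castSucc (Fin.last n).castSucc.succAbove).det
      = x (Fin.last n).castSucc (Fin.last _)
        * (x.submatrix (fun i : Fin n => i.castSucc.castSucc)
            (fun i : Fin n => i.castSucc.castSucc)).det := by
    have hlast : (Fin.last n).castSucc.succAbove (Fin.last n) = Fin.last (n + 1) := by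
      simp [Fin.succAbove]
    have hcast (i : Fin n) : (Fin.last n).castSucc.succAbove i.castSucc = i.castSucc.castSucc := by
      simp [Fin.succAbove, Fin.lt_def]
    rw [Matrix.det_succ_column _ (Fin.last n), Fin.sum_univ_castSucc, Finset.sum_eq_zero]
    · simp [Matrix.submatrix_submatrix, Function.comp_def, hlast, hcast]
    · intro i _
      rw [Matrix.submatrix_apply, hlast, htri _ _ (Or.inl (by simp))]
      simp
  rw [Matrix.det_succ_row _ (Fin.last _), Fin.sum_univ_castSucc, Fin.sum_univ_castSucc,
    Finset.sum_eq_zero]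
  · simp only [Fin.succAbove_last, minor, Fin.val_last, Fin.val_castSucc]
    have hodd : (-1 : R) ^ (n + 1 + n) = -1 := Odd.neg_one_pow ⟨n, by ring⟩
    have heven : (-1 : R) ^ (n + 1 + (n + 1)) = 1 := Even.neg_one_pow ⟨n + 1, rfl⟩
    rw [hodd, heven]
    ring
  · intro i _
    rw [htri _ _ (Or.inr (by simp))]
    simp

theorem mem_sparseSubsets {N j : ℕ} {s : Finset ℕ} :
    s ∈ sparseSubsets N j ↔ (∀ i ∈ s, i < N) ∧ s.card = j ∧ ∀ i ∈ s, i + 1 ∉ s := by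
  simp [sparseSubsets, Finset.subset_iff]

/-- The `j`-th elementary sum of products of `η` over the sparse subsets of `{0, …, N-1}`. -/
def sparseSum {R : Type*} [CommRing R] (η : ℕ → R) (N j : ℕ) : R :=
  ∑ s ∈ sparseSubsets N j, ∏ i ∈ s, η i

section sparseSum

variable {R : Type*} [CommRing R] (η : ℕ → R)

theorem sparseSum_zero_right (N : ℕ) : sparseSum η N 0 = 1 := by
  have h : sparseSubsets N 0 = {∅} := by
    ext s
    simp only [mem_sparseSubsets, Finset.card_eq_zero, Finset.mem_singleton]
    exact ⟨fun h => h.2.1, by rintro rfl; simp⟩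
  simp [sparseSum, h]

theorem sparseSum_zero_succ (j : ℕ) : sparseSum η 0 (j + 1) = 0 := by
  refine Finset.sum_eq_zero fun s hs => ?_
  obtain ⟨h, hc, -⟩ := mem_sparseSubsets.1 hs
  obtain ⟨i, hi⟩ := Finset.card_pos.1 (by omega : 0 < s.card)
  exact absurd (h i hi) (by omega)

theorem sparseSum_succ_succ (N j : ℕ) :
    sparseSum η (N + 1) (j + 1) = sparseSum η N (j + 1) + η N * sparseSum η (N - 1) j := by
  have hN {s : Finset ℕ} (hs : s ∈ sparseSubsets (N - 1) j) : N ∉ s := fun h => by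
    have := (mem_sparseSubsets.1 hs).1 N h
    omega
  unfold sparseSum
  rw [← Finset.sum_filter_add_sum_filter_not _ (fun s => N ∉ s), Finset.mul_sum]
  congr 1
  · refine Finset.sum_congr ?_ fun _ _ => rfl
    ext s
    simp only [Finset.mem_filter, mem_sparseSubsets]
    constructor
    · rintro ⟨⟨h, hc⟩, hs⟩
      refine ⟨fun i hi => ?_, hc⟩
      have := h i hi
      have : i ≠ N := fun e => hs (e ▸ hi)
      omega
    · rintro ⟨h, hc⟩
      exact ⟨⟨fun i hi => (h i hi).trans (Nat.lt_succ_self N), hc⟩,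
        fun hs => lt_irrefl _ (h N hs)⟩
  · symm
    refine Finset.sum_bij' (fun s _ => insert N s) (fun s _ => s.erase N) ?_ ?_ ?_ ?_ ?_
    · intro s hs
      have hNs := hN hs
      obtain ⟨h, hc, hsp⟩ := mem_sparseSubsets.1 hs
      simp only [Finset.mem_filter, mem_sparseSubsets, Finset.card_insert_of_notMem hNs, hc,
        Finset.mem_insert, true_or, not_true_eq_false, not_false_eq_true, and_true, true_and]
      constructor
      · rintro i (rfl | hi)
        · omega
        · have := h i hi
          omega
      · rintro i (rfl | hi) (hi' | hi')
        · omega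
        · have := h _ hi'
          omega
        · have := h _ hi
          omega
        · exact hsp i hi hi'
    · intro s hs
      simp only [Finset.mem_filter, mem_sparseSubsets, not_not] at hs
      obtain ⟨⟨h, hc, hsp⟩, hNs⟩ := hs
      simp only [mem_sparseSubsets, Finset.card_erase_of_mem hNs, hc, Finset.mem_erase]
      refine ⟨?_, by omega, fun i hi hi' => hsp i hi.2 hi'.2⟩
      rintro i ⟨hiN, hi⟩
      have := h i hi
      have : i + 1 ≠ N := fun e => hsp i hi (e ▸ hNs)
      omega
    · intro s hs
      exact Finset.erase_insert (hN hs)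
    · intro s hs
      simp only [Finset.mem_filter, not_not] at hs
      exact Finset.insert_erase hs.2
    · intro s hs
      exact (Finset.prod_insert (hN hs)).symm

theorem sparseSum_eq_zero (N j : ℕ) (h : N + 1 < 2 * j) : sparseSum η N j = 0 := by
  induction N using Nat.strong_induction_on generalizing j with
  | _ N ih =>
    obtain ⟨j, rfl⟩ : ∃ k, j = k + 1 := ⟨j - 1, by omega⟩
    cases N with
    | zero => exact sparseSum_zero_succ η j
    | succ N =>
      rw [sparseSum_succ_succ, ih N (by omega) _ (by omega), ih (N - 1) (by omega) _ (by omega)]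
      simp

/-- The continuant polynomial of order `n` with constant diagonal `a`, as a sum over sparse
subsets. -/
def sparseContinuant (a : R) (n : ℕ) : R :=
  ∑ j ∈ Finset.range (n / 2 + 1), (-1 : R) ^ j * sparseSum η (n - 1) j * a ^ (n - 2 * j)

theorem sparseContinuant_add_two (a : R) (n : ℕ) :
    sparseContinuant η a (n + 2)
      = a * sparseContinuant η a (n + 1) - η n * sparseContinuant η a n := by
  have hext : sparseContinuant η a (n + 1) = ∑ j ∈ Finset.range (n / 2 + 1 + 1),
      (-1 : R) ^ j * sparseSum η n j * a ^ (n + 1 - 2 * j) := by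
    refine Finset.sum_subset (Finset.range_subset_range.2 (by omega)) fun j _ hj => ?_
    rw [Finset.mem_range] at hj
    rw [sparseSum_eq_zero η _ _ (by omega)]
    simp
  rw [hext, sparseContinuant, sparseContinuant, show (n + 2) / 2 + 1 = n / 2 + 1 + 1 by omega,
    Finset.sum_range_succ', Finset.sum_range_succ' _ (n / 2 + 1), mul_add, Finset.mul_sum,
    Finset.mul_sum, add_sub_right_comm, ← Finset.sum_sub_distrib]
  congr 1
  · refine Finset.sum_congr rfl fun j _ => ?_
    rw [show n + 2 - 1 = n + 1 by omega, sparseSum_succ_succ,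
      show n + 2 - 2 * (j + 1) = n - 2 * j by omega]
    have key : sparseSum η n (j + 1) * a ^ (n - 2 * j)
        = sparseSum η n (j + 1) * (a * a ^ (n + 1 - 2 * (j + 1))) := by
      by_cases h : n + 1 < 2 * (j + 1)
      · simp [sparseSum_eq_zero η _ _ h]
      · rw [← pow_succ', show n + 1 - 2 * (j + 1) + 1 = n - 2 * j by omega]
    linear_combination (-1 : R) ^ (j + 1) * key
  · simp only [sparseSum_zero_right, pow_zero, mul_zero, Nat.sub_zero]
    ring

end sparseSum

theorem det_eq_sparseContinuant {R : Type*} [CommRing R] (a : R) (η : ℕ → R) (n : ℕ)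
    (x : Matrix (Fin n) (Fin n) R)
    (htri : ∀ i j : Fin n, ((i : ℕ) + 1 < (j : ℕ) ∨ (j : ℕ) + 1 < (i : ℕ)) → x i j = 0)
    (hdiag : ∀ i : Fin n, x i i = a)
    (hη : ∀ (i : ℕ) (h : i + 1 < n),
      η i = x ⟨i, Nat.lt_of_succ_lt h⟩ ⟨i + 1, h⟩ * x ⟨i + 1, h⟩ ⟨i, Nat.lt_of_succ_lt h⟩) :
    x.det = sparseContinuant η a n := by
  induction n using Nat.twoStepInduction with
  | zero => simp [sparseContinuant, sparseSum_zero_right]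
  | one => simp [sparseContinuant, sparseSum_zero_right, hdiag]
  | more n ih ih' =>
    rw [det_succ_succ_of_tridiagonal n x htri, sparseContinuant_add_two, hdiag,
      ih (x.submatrix (fun i : Fin n => i.castSucc.castSucc) (fun i : Fin n => i.castSucc.castSucc))
        (fun i j h => htri _ _ h) (fun i => hdiag _)
        (fun i h => hη i (by omega)),
      ih' (x.submatrix Fin.castSucc Fin.castSucc) (fun i j h => htri _ _ h) (fun i => hdiag _)
        (fun i h => hη i (by omega)),
      hη n (by omega)]
    rfl

/-- **Determinant of a tridiagonal matrix with constant main diagonal.**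
If `x` is an `n × n` tridiagonal matrix over a commutative ring whose diagonal entries all
equal `a`, `η i = x_{i,i+1} · x_{i+1,i}`, `m = ⌊n/2⌋`, and
`D = ∑_{j=0}^{m} (−1)^j (∑_{sparse S, |S| = j} ∏_{i ∈ S} η i) a^{2(m−j)}`
(whose `j = 0` term is `a^{2m}`, so `D = a^{2m} + ∑_{j=0}^{m-1} d_j a^{2j}` with
`d_{m−j} = (−1)^j ∑ ∏ η`), then `det x = D` for even `n` and `det x = a·D` for odd `n`. -/
theorem stmt0 {R : Type*} [CommRing R] (n : ℕ) (hn : 1 ≤ n)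
    (x : Matrix (Fin n) (Fin n) R) (a : R)
    (htri : ∀ i j : Fin n, ((i : ℕ) + 1 < (j : ℕ) ∨ (j : ℕ) + 1 < (i : ℕ)) → x i j = 0)
    (hdiag : ∀ i : Fin n, x i i = a)
    (η : ℕ → R)
    (hη : ∀ (i : ℕ) (h : i + 1 < n),
      η i = x ⟨i, Nat.lt_of_succ_lt h⟩ ⟨i + 1, h⟩ * x ⟨i + 1, h⟩ ⟨i, Nat.lt_of_succ_lt h⟩)
    (m : ℕ) (hm : m = n / 2)
    (D : R)
    (hD : D = ∑ j ∈ Finset.range (m + 1),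
      (-1 : R) ^ j * (∑ s ∈ sparseSubsets (n - 1) j, ∏ i ∈ s, η i) * a ^ (2 * (m - j))) :
    x.det = if Even n then D else a * D := by
  rw [det_eq_sparseContinuant a η n x htri hdiag hη, hD, sparseContinuant, ← hm]
  split_ifs with h
  · obtain ⟨k, hk⟩ := h
    refine Finset.sum_congr rfl fun j _ => ?_
    rw [show 2 * (m - j) = n - 2 * j by omega, sparseSum]
  · rw [Nat.not_even_iff_odd] at h
    obtain ⟨k, hk⟩ := h
    rw [Finset.mul_sum]
    refine Finset.sum_congr rfl fun j hj => ?_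
    rw [Finset.mem_range] at hj
    rw [show n - 2 * j = 2 * (m - j) + 1 by omega, sparseSum, pow_succ]
    ring
end

section
/- Let n ≥ 2, m = ⌊n/2⌋, and set X_k = 2cos(kπ/(n+1)) for k = 1,…,m. Then for every j with 0 ≤ j ≤ m, the j-th elementary symmetric polynomial of the numbers X_1², …, X_m² equals C(n−j, j); that is, Σ_{1 ≤ i_1 < ⋯ < i_j ≤ m} ∏_{k=1}^{j} 4cos²(i_k π/(n+1)) = C(n−j, j), where C(a,b) denotes the binomial coefficient. -/
/-- The polynomial `∑ C(n - j, j) Xʲ`, whose value at `1` is a Fibonacci number. -/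
noncomputable def fibChoosePoly (n : ℕ) : Polynomial ℝ :=
  ∑ p ∈ Finset.HasAntidiagonal.antidiagonal n, Polynomial.monomial p.2 (Nat.choose p.1 p.2 : ℝ)

theorem eval_fibChoosePoly (n : ℕ) (y : ℝ) :
    (fibChoosePoly n).eval y =
      ∑ p ∈ Finset.HasAntidiagonal.antidiagonal n, (Nat.choose p.1 p.2 : ℝ) * y ^ p.2 := by
  simp [fibChoosePoly, Polynomial.eval_finsetSum]

theorem coeff_fibChoosePoly {n j : ℕ} (hj : j ≤ n) :
    (fibChoosePoly n).coeff j = Nat.choose (n - j) j := by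
  rw [fibChoosePoly, Polynomial.finsetSum_coeff, Finset.sum_eq_single (n - j, j)]
  · simp
  · intro p hp hne
    refine Polynomial.coeff_monomial_of_ne _ fun h => hne ?_
    rw [Finset.HasAntidiagonal.mem_antidiagonal] at hp
    ext <;> simp <;> omega
  · intro h
    exact absurd (Finset.HasAntidiagonal.mem_antidiagonal.2 (by simp; omega)) h

theorem natDegree_fibChoosePoly_le (n : ℕ) : (fibChoosePoly n).natDegree ≤ n / 2 := by
  refine Polynomial.natDegree_sum_le_of_forall_le _ _ fun p hp => ?_
  rw [Finset.HasAntidiagonal.mem_antidiagonal] at hp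
  by_cases h : p.2 ≤ p.1
  · exact (Polynomial.natDegree_monomial_le _).trans (by omega)
  · simp [Nat.choose_eq_zero_of_lt (not_le.1 h)]

theorem eval_fibChoosePoly_add_two (n : ℕ) (y : ℝ) :
    (fibChoosePoly (n + 2)).eval y =
      (fibChoosePoly (n + 1)).eval y + y * (fibChoosePoly n).eval y := by
  simp only [eval_fibChoosePoly]
  rw [Finset.Nat.antidiagonal_succ_succ', Finset.Nat.antidiagonal_succ']
  simp [Nat.choose_succ_succ, Finset.sum_add_distrib, add_mul, Finset.mul_sum, pow_succ]
  have h : ∀ p : ℕ × ℕ, y * ((p.1.choose p.2 : ℝ) * y ^ p.2) =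
    (p.1.choose p.2 : ℝ) * (y ^ p.2 * y) := fun p => by ring
  simp only [h]
  ring

theorem sin_mul_eval_fibChoosePoly {θ : ℝ} (hθ : Real.cos θ ≠ 0) (n : ℕ) :
    Real.sin θ * (2 * Real.cos θ) ^ n *
        (fibChoosePoly n).eval (-(4 * Real.cos θ ^ 2)⁻¹) = Real.sin ((n + 1) * θ) := by
  induction n using Nat.twoStepInduction with
  | zero => simp [eval_fibChoosePoly]
  | one =>
    have h : ((1 : ℕ) + 1 : ℝ) * θ = 2 * θ := by norm_num
    rw [h, Real.sin_two_mul]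
    simp [eval_fibChoosePoly, Finset.Nat.antidiagonal_succ]
    ring
  | more n ih₀ ih₁ =>
    have h : Real.sin (((n + 2 : ℕ) + 1 : ℝ) * θ) =
        2 * Real.cos θ * Real.sin (((n + 1 : ℕ) + 1 : ℝ) * θ) - Real.sin ((n + 1) * θ) := by
      have h₂ : ((n + 2 : ℕ) + 1 : ℝ) * θ = ((n + 1 : ℕ) + 1 : ℝ) * θ + θ := by push_cast; ring
      have h₀ : ((n : ℝ) + 1) * θ = ((n + 1 : ℕ) + 1 : ℝ) * θ - θ := by push_cast; ring
      rw [h₂, h₀, Real.sin_add, Real.sin_sub]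
      ring
    rw [h, ← ih₀, ← ih₁, eval_fibChoosePoly_add_two]
    field_simp
    ring

theorem coeff_prod_one_add_C_mul_X {ι : Type*} (s : Finset ι) (a : ι → ℝ) (j : ℕ) :
    (∏ i ∈ s, (1 + Polynomial.C (a i) * Polynomial.X)).coeff j =
      ∑ t ∈ Finset.powersetCard j s, ∏ i ∈ t, a i := by
  classical
  simp only [Finset.prod_one_add, Finset.prod_mul_distrib, Finset.prod_const,
    Polynomial.finsetSum_coeff, ← map_prod, Polynomial.coeff_C_mul_X_pow]
  rw [← Finset.sum_filter, Finset.powersetCard_eq_filter]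
  simp only [eq_comm]

theorem natDegree_prod_one_add_C_mul_X_le {ι : Type*} (s : Finset ι) (a : ι → ℝ) :
    (∏ i ∈ s, (1 + Polynomial.C (a i) * Polynomial.X)).natDegree ≤ s.card := by
  refine (Polynomial.natDegree_prod_le _ _).trans ?_
  refine (Finset.sum_le_card_nsmul _ _ 1 fun i _ => ?_).trans (by simp)
  compute_degree

/-- A polynomial of degree at most `#s` with constant coefficient `1` and roots `-1 / aᵢ`, for
distinct nonzero `aᵢ`, is `∏ (1 + aᵢ X)`. -/
theorem eq_prod_one_add_C_mul_X {ι : Type*} {s : Finset ι} {a : ι → ℝ} {P : Polynomial ℝ}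
    (hinj : Set.InjOn a s) (ha : ∀ i ∈ s, a i ≠ 0) (hdeg : P.natDegree ≤ s.card)
    (h0 : P.eval 0 = 1) (hroot : ∀ i ∈ s, P.eval (-(a i)⁻¹) = 0) :
    P = ∏ i ∈ s, (1 + Polynomial.C (a i) * Polynomial.X) := by
  classical
  have hinj' : Set.InjOn (fun i => -(a i)⁻¹) s := fun i hi k hk h =>
    hinj hi hk (inv_injective (neg_injective h))
  have hcard : (insert 0 (s.image fun i => -(a i)⁻¹)).card = s.card + 1 := by
    rw [Finset.card_insert_of_notMem, Finset.card_image_of_injOn hinj']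
    simpa using ha
  refine Polynomial.eq_of_degrees_lt_of_eval_finset_eq
    (insert 0 (s.image fun i => -(a i)⁻¹)) ?_ ?_ ?_
  · rw [hcard]
    exact Polynomial.degree_le_natDegree.trans_lt (by exact_mod_cast Nat.lt_succ_of_le hdeg)
  · rw [hcard]
    exact Polynomial.degree_le_natDegree.trans_lt
      (by exact_mod_cast Nat.lt_succ_of_le (natDegree_prod_one_add_C_mul_X_le s a))
  · intro y hy
    rw [Polynomial.eval_prod]
    rcases Finset.mem_insert.1 hy with rfl | hy
    · simp [h0]
    · obtain ⟨i, hi, rfl⟩ := Finset.mem_image.1 hy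
      rw [hroot i hi, Finset.prod_eq_zero hi]
      simp [ha i hi]

/-- **Elementary symmetric polynomials of the squared positive eigenvalues.**
For `n ≥ 2`, `m = ⌊n/2⌋`, `X_k = 2cos(kπ/(n+1))` (`k = 1,…,m`) and `0 ≤ j ≤ m`, the `j`-th
elementary symmetric polynomial of `X_1², …, X_m²` equals `C(n−j, j)`:
`∑_{1 ≤ i_1 < ⋯ < i_j ≤ m} ∏_k 4cos²(i_k π/(n+1)) = C(n−j, j)`. -/
theorem stmt6 (n : ℕ) (hn : 2 ≤ n) (m : ℕ) (hm : m = n / 2) (j : ℕ) (hj : j ≤ m) :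
    ∑ s ∈ Finset.powersetCard j (Finset.range m),
      ∏ i ∈ s, (4 * Real.cos ((i + 1) * Real.pi / (n + 1)) ^ 2) =
      (Nat.choose (n - j) j : ℝ) := by
  have hn0 : (0 : ℝ) < n + 1 := by positivity
  have hpos (i : ℕ) : 0 < ((i : ℝ) + 1) * Real.pi / (n + 1) := by positivity
  have hlt {i : ℕ} (hi : i ∈ Finset.range m) :
      ((i : ℝ) + 1) * Real.pi / (n + 1) < Real.pi / 2 := by
    have h : 2 * ((i : ℝ) + 1) < n + 1 := by
      have := Finset.mem_range.1 hi
      have : 2 * (i + 1) < n + 1 := by omega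
      exact_mod_cast this
    rw [div_lt_div_iff₀ hn0 two_pos]
    nlinarith [Real.pi_pos]
  have hcos {i : ℕ} (hi : i ∈ Finset.range m) :
      0 < Real.cos (((i : ℝ) + 1) * Real.pi / (n + 1)) :=
    Real.cos_pos_of_mem_Ioo ⟨by linarith [hpos i, Real.pi_pos], hlt hi⟩
  rw [← coeff_prod_one_add_C_mul_X, ← coeff_fibChoosePoly (show j ≤ n by omega)]
  congr 1
  symm
  apply eq_prod_one_add_C_mul_X
  · intro i hi k hk h
    have hsq := mul_left_cancel₀ (four_ne_zero (α := ℝ)) h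
    have hc := (pow_left_inj₀ (hcos hi).le (hcos hk).le two_ne_zero).1 hsq
    have hang := Real.injOn_cos ⟨(hpos i).le, by linarith [hlt hi, Real.pi_pos]⟩
      ⟨(hpos k).le, by linarith [hlt hk, Real.pi_pos]⟩ hc
    have hπ := Real.pi_ne_zero
    field_simp at hang
    exact_mod_cast add_right_cancel hang
  · intro i hi
    have := hcos hi
    positivity
  · simpa [hm] using natDegree_fibChoosePoly_le n
  · rw [← Polynomial.coeff_zero_eq_eval_zero, coeff_fibChoosePoly n.zero_le]
    simp
  · intro i hi
    have h := sin_mul_eval_fibChoosePoly (hcos hi).ne' n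
    have hsin := Real.sin_pos_of_pos_of_lt_pi (hpos i) (by linarith [hlt hi, Real.pi_pos])
    have hang : ((n : ℝ) + 1) * (((i : ℝ) + 1) * Real.pi / (n + 1)) = (i + 1 : ℕ) * Real.pi := by
      push_cast
      field_simp
    rw [hang, Real.sin_nat_mul_pi] at h
    have := hcos hi
    exact (mul_eq_zero.1 h).resolve_left (by positivity)
end
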